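/- For T ∈ GL(2d, ℝ), the following are equivalent: (a) T is symplectic; (b) (TA)° = T·A° for some A ∈ GL(2d, ℝ); (c) (TA)° = T·A° for all A ∈ GL(2d, ℝ). Here X° = -J X^{-T}. -/

import Mathlib

open Matrix

theorem stmt_7 (d : ℕ) (T J : Matrix (Fin d ⊕ Fin d) (Fin d ⊕ Fin d) ℝ)
    (hJ : J = fromBlocks 0 1 (-1) 0) (hT : IsUnit T) :
    (Tᵀ * J * T = J ↔
      ∃ A : Matrix (Fin d ⊕ Fin d) (Fin d ⊕ Fin d) ℝ, IsUnit A ∧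
        -J * ((T * A)⁻¹)ᵀ = T * (-J * (A⁻¹)ᵀ)) ∧
    (Tᵀ * J * T = J ↔
      ∀ A : Matrix (Fin d ⊕ Fin d) (Fin d ⊕ Fin d) ℝ, IsUnit A →
        -J * ((T * A)⁻¹)ᵀ = T * (-J * (A⁻¹)ᵀ)) := by
  have hJ' : J = -Matrix.J (Fin d) ℝ := by
    rw [hJ, Matrix.J, fromBlocks_neg]; simp
  have h1 : Tᵀ * J * T = J ↔ T * J * Tᵀ = J := by
    have h := (SymplecticGroup.mem_iff (A := T)).symm.trans (SymplecticGroup.mem_iff' (A := T))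
    rw [hJ']
    simpa using h.symm
  have hTd : IsUnit T.det := (Matrix.isUnit_iff_isUnit_det T).1 hT
  have hTi : (T⁻¹)ᵀ * Tᵀ = 1 := by
    rw [← transpose_mul, Matrix.mul_nonsing_inv _ hTd, transpose_one]
  have hTi' : Tᵀ * (T⁻¹)ᵀ = 1 := by
    rw [← transpose_mul, Matrix.nonsing_inv_mul _ hTd, transpose_one]
  have key : ∀ A : Matrix (Fin d ⊕ Fin d) (Fin d ⊕ Fin d) ℝ, IsUnit A →
      (-J * ((T * A)⁻¹)ᵀ = T * (-J * (A⁻¹)ᵀ) ↔ Tᵀ * J * T = J) := by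
    intro A hA
    have hAd : IsUnit A.det := (Matrix.isUnit_iff_isUnit_det A).1 hA
    have hAi : (A⁻¹)ᵀ * Aᵀ = 1 := by
      rw [← transpose_mul, Matrix.mul_nonsing_inv _ hAd, transpose_one]
    rw [h1, Matrix.mul_inv_rev, transpose_mul]
    constructor
    · intro h
      have h2 := congrArg (fun M => -(M * Aᵀ * Tᵀ)) h
      simp only [Matrix.mul_assoc, Matrix.neg_mul, Matrix.mul_neg, neg_neg] at h2
      rw [← Matrix.mul_assoc (A⁻¹)ᵀ, hAi, Matrix.one_mul, hTi, Matrix.mul_one] at h2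
      rw [Matrix.mul_assoc]
      exact h2.symm
    · intro h
      have h2 : J * (T⁻¹)ᵀ = T * J := by
        conv_lhs => rw [← h]
        rw [Matrix.mul_assoc, hTi', Matrix.mul_one]
      rw [← Matrix.mul_assoc, Matrix.neg_mul, h2]
      simp [Matrix.mul_assoc]
  refine ⟨⟨fun h => ⟨1, isUnit_one, (key 1 isUnit_one).2 h⟩, ?_⟩,
    fun h A hA => (key A hA).2 h, fun h => (key 1 isUnit_one).1 (h 1 isUnit_one)⟩
  rintro ⟨A, hA, h⟩
  exact (key A hA).1 h
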